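/- arXiv:2004.05596 — 4 statements merged into one kernel-verified Lean document; each statement's English description precedes it below -/
import Mathlib

section
/- (Govorov; Ufnarovskij) Let X be a finite alphabet and let U be a finite set of words over X. For n ≥ 0 let b_n be the number of words of length n over X having no factor belonging to U. Then the generating function ∑_{n≥0} b_n t^n is a rational function: there exist polynomials p(t), q(t) with integer coefficients and q ≠ 0 such that q(t)·∑_{n≥0} b_n t^n = p(t) in ℤ⟦t⟧. (Equivalently, the Hilbert series of the finitely presented monomial algebra K⟨X⟩/(U) is rational.) -/
open Polynomial in
/-- A sequence of vectors obtained by iterating an integer matrix has rational coordinate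
generating functions. -/
theorem exists_polynomial_mul_mk_eq_of_matrix_recurrence {σ : Type*} [Fintype σ]
    [DecidableEq σ] (A : Matrix σ σ ℤ) (a : ℕ → σ → ℤ)
    (ha : ∀ n, a (n + 1) = A.mulVec (a n)) (s : σ) :
    ∃ p q : ℤ[X], q ≠ 0 ∧
      (q : PowerSeries ℤ) * PowerSeries.mk (fun n => a n s) = (p : PowerSeries ℤ) := by
  let B : Matrix σ σ ℤ[X] := 1 - (X : ℤ[X]) • A.map C
  let φ : ℤ[X] →+* PowerSeries ℤ := Polynomial.coeToPowerSeries.ringHom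
  let F : σ → PowerSeries ℤ := fun i => PowerSeries.mk (fun n => a n i)
  have hF : (B.map φ).mulVec F = fun i => φ (C (a 0 i)) := by
    have hB : B.map φ = 1 - (PowerSeries.X : PowerSeries ℤ) • A.map PowerSeries.C := by
      ext1 i j
      by_cases h : i = j <;>
        simp [B, φ, h, -eq_intCast, Polynomial.coe_C, mul_comm PowerSeries.X]
    rw [hB, Matrix.sub_mulVec, Matrix.one_mulVec, Matrix.smul_mulVec]
    funext i
    ext n
    cases n with
    | zero => simp [F, φ]
    | succ n =>
      simp [F, φ, Matrix.mulVec, dotProduct, PowerSeries.coeff_succ_X_mul, ha,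
        -eq_intCast, Polynomial.coe_C]
  refine ⟨B.adjugate.mulVec (fun i => C (a 0 i)) s, B.det, ?_, ?_⟩
  · intro h
    have h0 := congrArg (Polynomial.evalRingHom (0 : ℤ)) h
    rw [RingHom.map_det] at h0
    have h1 : (Polynomial.evalRingHom (0 : ℤ)).mapMatrix B = 1 := by
      ext i j
      by_cases h : i = j <;> simp [B, Matrix.one_apply, h]
    simp [h1] at h0
  · have h := congrArg (fun v => (B.map φ).adjugate.mulVec v s) hF
    simp only [Matrix.mulVec_mulVec, Matrix.adjugate_mul, Matrix.smul_mulVec,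
      Matrix.one_mulVec, Pi.smul_apply, smul_eq_mul] at h
    change φ B.det * F s = φ (B.adjugate.mulVec (fun i => C (a 0 i)) s)
    rw [RingHom.map_det, RingHom.mapMatrix_apply, h, RingHom.map_mulVec,
      ← RingHom.mapMatrix_apply, ← RingHom.mapMatrix_apply, RingHom.map_adjugate]
    rfl

/-- The generating function of a regular language is rational. -/
theorem Language.IsRegular.exists_polynomial_mul_mk_eq {α : Type*} [Fintype α]
    {L : Language α} (hL : L.IsRegular) :
    ∃ p q : Polynomial ℤ, q ≠ 0 ∧
      (q : PowerSeries ℤ) *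
        PowerSeries.mk (fun n => (({w : List α | w.length = n ∧ w ∈ L}).ncard : ℤ)) =
      (p : PowerSeries ℤ) := by
  classical
  obtain ⟨σ, _, M, rfl⟩ := hL
  let a : ℕ → σ → ℤ := fun n s => ({w : List α | w.length = n ∧ w ∈ M.acceptsFrom s}).ncard
  let A : Matrix σ σ ℤ := fun s t => ∑ x : α, if M.step s x = t then 1 else 0
  refine exists_polynomial_mul_mk_eq_of_matrix_recurrence A a (fun n => ?_) M.start
  funext s
  have hunion : {w : List α | w.length = n + 1 ∧ w ∈ M.acceptsFrom s} =
      ⋃ x : α,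
        List.cons x '' {w : List α | w.length = n ∧ w ∈ M.acceptsFrom (M.step s x)} := by
    ext w
    cases w <;> simp [DFA.mem_acceptsFrom]
  have hsum : a (n + 1) s = ∑ x : α, a n (M.step s x) := by
    have hfin (x : α) : (List.cons x ''
        {w : List α | w.length = n ∧ w ∈ M.acceptsFrom (M.step s x)}).Finite :=
      ((List.finite_length_eq α n).subset fun _ h => h.1).image _
    have hdisj : Pairwise (Function.onFun Disjoint fun x : α => List.cons x ''
        {w : List α | w.length = n ∧ w ∈ M.acceptsFrom (M.step s x)}) := by
      intro x y hxy
      refine Set.disjoint_left.2 ?_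
      rintro _ ⟨u, -, rfl⟩ ⟨v, -, h⟩
      exact hxy (List.cons.inj h).1.symm
    have h : ({w : List α | w.length = n + 1 ∧ w ∈ M.acceptsFrom s}).ncard =
        ∑ x : α, ({w : List α | w.length = n ∧ w ∈ M.acceptsFrom (M.step s x)}).ncard := by
      rw [hunion, Set.ncard_iUnion_of_finite hfin hdisj, finsum_eq_sum_of_fintype]
      exact Finset.sum_congr rfl fun x _ =>
        Set.ncard_image_of_injective _ List.cons_injective
    simp only [a, h, Nat.cast_sum]
  simp only [hsum, A, Matrix.mulVec, dotProduct, Finset.sum_mul, ite_mul, one_mul, zero_mul]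
  rw [Finset.sum_comm]
  simp

theorem List.infix_append_iff_exists {α : Type*} {v x y : List α} :
    v <:+: x ++ y ↔ v <:+: x ∨ v <:+: y ∨ ∃ a s, a ++ s = v ∧ a <:+ x ∧ s <+: y := by
  constructor
  · rintro ⟨p, q, h⟩
    rcases List.append_eq_append_iff.1 h with ⟨c, rfl, rfl⟩ | ⟨c, h1, rfl⟩
    · exact .inl ⟨p, c, rfl⟩
    · rcases List.append_eq_append_iff.1 h1 with ⟨d, rfl, rfl⟩ | ⟨d, rfl, rfl⟩
      · exact .inr (.inr ⟨d, c, rfl, ⟨p, rfl⟩, ⟨q, rfl⟩⟩)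
      · exact .inr (.inl ⟨d, q, rfl⟩)
  · rintro (h | h | ⟨a, s, rfl, ⟨p, rfl⟩, ⟨q, rfl⟩⟩)
    · exact h.trans (List.prefix_append x y).isInfix
    · exact h.trans (List.suffix_append x y).isInfix
    · exact ⟨p, q, by simp⟩

/-- The words avoiding finitely many factors form a regular language. -/
theorem Language.isRegular_setOf_forall_not_infix {α : Type*} (U : Finset (List α)) :
    Language.IsRegular ({w : List α | ∀ v ∈ U, ¬ v <:+: w} : Language α) := by
  refine Language.IsRegular.of_finite_range_leftQuotient ?_
  let T : Set (List α) := ⋃ v ∈ U, {s | s ∈ v.tails}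
  have hT : T.Finite := U.finite_toSet.biUnion fun v _ => List.finite_toSet _
  let residual : Prop × Set (List α) → Language α := fun c =>
    {y | c.1 ∧ (∀ v ∈ U, ¬ v <:+: y) ∧ ∀ s ∈ c.2, ¬ s <+: y}
  refine ((Set.finite_univ.prod hT.powerset).image residual).subset ?_
  rintro _ ⟨x, rfl⟩
  refine ⟨(∀ v ∈ U, ¬ v <:+: x, {s | ∃ v ∈ U, ∃ a, a ++ s = v ∧ a <:+ x}), ⟨trivial, ?_⟩, ?_⟩
  · rintro s ⟨v, hv, a, rfl, -⟩
    simp only [T, Set.mem_iUnion, Set.mem_ofPred_eq, List.mem_tails]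
    exact ⟨_, hv, List.suffix_append a s⟩
  · apply Set.ext
    intro y
    change ((∀ v ∈ U, ¬ v <:+: x) ∧ (∀ v ∈ U, ¬ v <:+: y) ∧
      ∀ s, (∃ v ∈ U, ∃ a, a ++ s = v ∧ a <:+ x) → ¬ s <+: y) ↔ ∀ v ∈ U, ¬ v <:+: x ++ y
    simp only [List.infix_append_iff_exists]
    grind


/-- **Govorov; Ufnarovskij.** Let `X` be a finite alphabet and `U` a finite set of words over
`X`. Then the generating function of the numbers `bₙ` of words of length `n` over `X` with no
factor in `U` is rational: `q(t) · ∑ bₙ tⁿ = p(t)` in `ℤ⟦t⟧` for some integer polynomials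
`p, q` with `q ≠ 0`.  (Equivalently, the Hilbert series of the finitely presented monomial
algebra `K⟨X⟩/(U)` is rational.) -/
theorem govorov_hilbert_series_of_monomial_algebra_rational
    (X : Type) [Fintype X] (U : Finset (List X)) :
    ∃ p q : Polynomial ℤ, q ≠ 0 ∧
      (q : PowerSeries ℤ) *
        PowerSeries.mk
          (fun n => (({w : List X | w.length = n ∧ ∀ v ∈ U, ¬ v <:+: w}).ncard : ℤ)) =
      (p : PowerSeries ℤ) := by
  exact (Language.isRegular_setOf_forall_not_infix U).exists_polynomial_mul_mk_eq
end

section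
/- Let A be a nonempty set of positive integers, let d be the greatest common divisor of the elements of A, let M be the additive submonoid of ℕ generated by A, and let s be a positive integer. Then the set {m ∈ M : s divides 1 + m} is nonempty if and only if gcd(d, s) = 1; moreover, this set is either empty or infinite. (Applied with A = {n−1 : Ω has an n-ary operation}, this determines exactly when the set S_Ω of elements of the one-generated free Ω-magma of degree divisible by s is nonempty, and shows that S_Ω is either empty or infinite.) -/
/-- The integers congruent modulo `s` to an element of a given additive submonoid of `ℕ`. -/
def AddSubmonoid.residueSubgroup (M : AddSubmonoid ℕ) (s : ℕ) (hs : 0 < s) : AddSubgroup ℤ where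
  carrier := {x | ∃ m ∈ M, (s : ℤ) ∣ m - x}
  zero_mem' := ⟨0, M.zero_mem, by simp⟩
  add_mem' := by
    rintro x y ⟨m, hm, hmx⟩ ⟨n, hn, hny⟩
    refine ⟨m + n, M.add_mem hm hn, ?_⟩
    have h := dvd_add hmx hny
    push_cast
    rwa [show (m + n - (x + y) : ℤ) = m - x + (n - y) by ring]
  neg_mem' := by
    rintro x ⟨m, hm, k, hk⟩
    refine ⟨(s - 1) • m, M.nsmul_mem hm _, m - k, ?_⟩
    rw [smul_eq_mul]
    push_cast [Nat.cast_sub (show 1 ≤ s from hs)]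
    linear_combination -hk

theorem AddSubmonoid.mem_residueSubgroup {M : AddSubmonoid ℕ} {s : ℕ} {hs : 0 < s} {x : ℤ} :
    x ∈ M.residueSubgroup s hs ↔ ∃ m ∈ M, (s : ℤ) ∣ m - x :=
  Iff.rfl

theorem dvd_of_mem_addSubmonoid_closure {A : Set ℕ} {d m : ℕ} (hdvd : ∀ a ∈ A, d ∣ a)
    (hm : m ∈ AddSubmonoid.closure A) : d ∣ m := by
  induction hm using AddSubmonoid.closure_induction with
  | mem x hx => exact hdvd x hx
  | zero => exact dvd_zero d
  | add x y _ _ hx hy => exact dvd_add hx hy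

theorem exists_mem_addSubmonoid_closure_dvd_one_add {A : Set ℕ} {d s : ℕ}
    (hmax : ∀ e : ℕ, (∀ a ∈ A, e ∣ a) → e ∣ d) (hs : 0 < s) (hds : Nat.gcd d s = 1) :
    ∃ m ∈ AddSubmonoid.closure A, s ∣ 1 + m := by
  set K := (AddSubmonoid.closure A).residueSubgroup s hs
  obtain ⟨e, he⟩ := Int.subgroup_cyclic K
  have hK : ∀ x : ℤ, x ∈ K ↔ e ∣ x := fun x => by
    rw [he, ← AddSubgroup.zmultiples_eq_closure, Int.mem_zmultiples_iff]
  have hed : e.natAbs ∣ d := hmax _ fun a ha => Int.natAbs_dvd_natAbs.2 <|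
    (hK a).1 <| AddSubmonoid.mem_residueSubgroup.2
      ⟨a, AddSubmonoid.subset_closure ha, by simp⟩
  have hes : e.natAbs ∣ s := Int.natAbs_dvd_natAbs.2 <|
    (hK s).1 <| AddSubmonoid.mem_residueSubgroup.2 ⟨0, AddSubmonoid.zero_mem _, by simp⟩
  have he_one : e.natAbs ∣ 1 := hds ▸ Nat.dvd_gcd hed hes
  have h_neg_one : (-1 : ℤ) ∈ K := (hK _).2 <| Int.natAbs_dvd_natAbs.1 he_one
  obtain ⟨m, hm, hsm⟩ := AddSubmonoid.mem_residueSubgroup.1 h_neg_one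
  refine ⟨m, hm, ?_⟩
  rw [sub_neg_eq_add, add_comm] at hsm
  exact_mod_cast hsm


/-- Let `A` be a nonempty set of positive integers with greatest common divisor `d`, let `M` be
the additive submonoid of `ℕ` generated by `A`, and let `s` be a positive integer. Then
`{m ∈ M : s ∣ 1 + m}` is nonempty if and only if `gcd(d,s) = 1`; moreover this set is either
empty or infinite.  (Applied to `A = {n−1 : Ω has an n-ary operation}`, this determines when
the set of elements of the one-generated free `Ω`-magma of degree divisible by `s` is nonempty,
and shows it is either empty or infinite.) -/
theorem degrees_divisible_by_s_nonempty_iff (A : Set ℕ) (hA : A.Nonempty)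
    (hpos : ∀ a ∈ A, 0 < a) (d : ℕ)
    (hdvd : ∀ a ∈ A, d ∣ a) (hmax : ∀ e : ℕ, (∀ a ∈ A, e ∣ a) → e ∣ d)
    (s : ℕ) (hs : 0 < s) :
    (({m : ℕ | m ∈ AddSubmonoid.closure A ∧ s ∣ 1 + m}).Nonempty ↔ Nat.gcd d s = 1) ∧
    (({m : ℕ | m ∈ AddSubmonoid.closure A ∧ s ∣ 1 + m}) = ∅ ∨
      ({m : ℕ | m ∈ AddSubmonoid.closure A ∧ s ∣ 1 + m}).Infinite) := by
  refine ⟨⟨?_, exists_mem_addSubmonoid_closure_dvd_one_add hmax hs⟩, ?_⟩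
  · rintro ⟨m, hm, hsm⟩
    have hdm := dvd_of_mem_addSubmonoid_closure hdvd hm
    exact Nat.dvd_one.1 <| (Nat.dvd_add_left ((Nat.gcd_dvd_left d s).trans hdm)).1
      ((Nat.gcd_dvd_right d s).trans hsm)
  · refine Set.eq_empty_or_nonempty _ |>.imp_right ?_
    rintro ⟨m, hm, hsm⟩
    obtain ⟨a, ha⟩ := hA
    have hsa : 0 < s * a := Nat.mul_pos hs (hpos a ha)
    refine Set.infinite_of_injective_forall_mem (f := fun k : ℕ => m + k * (s * a)) ?_ ?_
    · intro k l hkl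
      exact Nat.eq_of_mul_eq_mul_right hsa (Nat.add_left_cancel hkl)
    · intro k
      refine ⟨add_mem hm ?_, ?_⟩
      · rw [← mul_assoc, ← smul_eq_mul]
        exact nsmul_mem (AddSubmonoid.subset_closure ha) _
      · rw [← add_assoc]
        exact dvd_add hsm (dvd_mul_of_dvd_right (dvd_mul_right s a) k)
end

section
/- (Lane; Kharchenko) Let d ≥ 1 and let G be any subgroup of GL_d(ℂ), acting on the free associative algebra ℂ⟨x_1,…,x_d⟩ (the tensor algebra of the vector space V = ℂ^d) by algebra automorphisms extending the natural linear action of G on the span of x_1,…,x_d. Then the algebra of invariants ℂ⟨x_1,…,x_d⟩^G = {f : g(f) = f for all g ∈ G} is a free associative algebra: there exists a set Y and a ℂ-algebra isomorphism from ℂ⟨x_1,…,x_d⟩^G onto the free associative algebra ℂ⟨Y⟩. -/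
open scoped TensorProduct

/-- The algebra automorphism of the free associative algebra `ℂ⟨x₁,…,x_d⟩` (the tensor algebra
of `V = ℂ^d`) induced by the natural linear action of an invertible matrix `g ∈ GL_d(ℂ)` on
`V`. -/
noncomputable def glAction (d : ℕ) (g : Matrix.GeneralLinearGroup (Fin d) ℂ) :
    TensorAlgebra ℂ (Fin d → ℂ) →ₐ[ℂ] TensorAlgebra ℂ (Fin d → ℂ) :=
  TensorAlgebra.lift ℂ
    ((TensorAlgebra.ι ℂ).comp (Matrix.mulVecLin (g : Matrix (Fin d) (Fin d) ℂ)))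

/-- The subalgebra of `G`-invariants of the free associative algebra `ℂ⟨x₁,…,x_d⟩`. -/
noncomputable def glInvariants (d : ℕ) (G : Subgroup (Matrix.GeneralLinearGroup (Fin d) ℂ)) :
    Subalgebra ℂ (TensorAlgebra ℂ (Fin d → ℂ)) where
  carrier := {f | ∀ g ∈ G, glAction d g f = f}
  mul_mem' := fun ha hb g hg => by rw [map_mul, ha g hg, hb g hg]
  add_mem' := fun ha hb g hg => by rw [map_add, ha g hg, hb g hg]
  algebraMap_mem' := fun r g hg => (glAction d g).commutes r

namespace FreeAlgebra

variable {k T Y : Type*} [Field k] [Ring T] [Algebra k T]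

/-- The `k`-linear map `c ↦ ∑ y, v y * c y` attached to a family `v` in an algebra. -/
noncomputable def rightCombination (k : Type*) {T Y : Type*} [Field k] [Ring T] [Algebra k T]
    (v : Y → T) : (Y →₀ T) →ₗ[k] T :=
  Finsupp.lsum k fun y => LinearMap.mulLeft k (v y)

theorem rightCombination_apply (v : Y → T) (c : Y →₀ T) :
    rightCombination k v c = c.sum fun y a => v y * a := by
  rfl

@[simp]
theorem rightCombination_single (v : Y → T) (y : Y) (a : T) :
    rightCombination k v (Finsupp.single y a) = v y * a := by
  simp [rightCombination_apply]

/-- An algebra homomorphism commutes with taking right combinations. -/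
theorem map_rightCombination {T' : Type*} [Ring T'] [Algebra k T'] (φ : T →ₐ[k] T')
    (v : Y → T) (c : Y →₀ T) :
    φ (rightCombination k v c) =
      rightCombination k (φ ∘ v) (c.mapRange φ (map_zero φ)) := by
  rw [rightCombination_apply, rightCombination_apply, Finsupp.sum_mapRange_index (by simp),
    Finsupp.sum, Finsupp.sum, map_sum]
  simp

theorem rightCombination_mul (v : Y → T) (c : Y →₀ T) (f : T) :
    rightCombination k v c * f =
      rightCombination k v (c.mapRange (· * f) (zero_mul f)) := by
  rw [rightCombination_apply, rightCombination_apply, Finsupp.sum_mapRange_index (by simp),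
    Finsupp.sum, Finsupp.sum, Finset.sum_mul]
  simp [mul_assoc]

/-- Every element of the free algebra is a scalar plus a right combination of the generators. -/
theorem exists_eq_algebraMap_add_rightCombination (p : FreeAlgebra k Y) :
    ∃ (r : k) (c : Y →₀ FreeAlgebra k Y), p = algebraMap k _ r + rightCombination k (ι k) c := by
  induction p using FreeAlgebra.induction with
  | grade0 r => exact ⟨r, 0, by simp⟩
  | grade1 y => exact ⟨0, Finsupp.single y 1, by simp⟩
  | add a b ha hb =>
    obtain ⟨r, c, rfl⟩ := ha
    obtain ⟨s, d, rfl⟩ := hb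
    exact ⟨r + s, c + d, by simp only [map_add]; abel⟩
  | mul a b ha hb =>
    obtain ⟨r, c, rfl⟩ := ha
    obtain ⟨s, d, hd⟩ := hb
    refine ⟨r * s, r • d + c.mapRange (· * b) (zero_mul b), ?_⟩
    rw [add_mul, rightCombination_mul, map_add, map_smul, map_mul, ← add_assoc]
    congr 1
    nth_rw 1 [hd]
    rw [mul_add, Algebra.smul_def]

/-- If a family killed by an augmentation is right independent, then the algebra homomorphism
from the free algebra it determines is injective. -/
theorem lift_injective_of_rightCombination_injective (v : Y → T) (ε : T →ₐ[k] k)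
    (hε : ∀ y, ε (v y) = 0) (hv : Function.Injective (rightCombination k v)) :
    Function.Injective (lift k v) := by
  have key : ∀ (w : FreeMonoid Y) (p : FreeAlgebra k Y), lift k v p = 0 →
      (equivMonoidAlgebraFreeMonoid p).coeff w = 0 := by
    intro w
    have peel : ∀ p : FreeAlgebra k Y, lift k v p = 0 →
        ∃ c : Y →₀ FreeAlgebra k Y, (∀ y, lift k v (c y) = 0) ∧
          p = c.sum fun y a => ι k y * a := by
      intro p hp
      obtain ⟨r, c, rfl⟩ := exists_eq_algebraMap_add_rightCombination p
      rw [map_add, map_rightCombination, AlgHom.commutes] at hp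
      have hr : r = 0 := by
        have := congrArg ε hp
        rw [map_add, AlgHom.commutes, map_rightCombination, rightCombination_apply] at this
        simpa [hε, Finsupp.sum] using this
      subst hr
      rw [map_zero, zero_add] at hp
      have hcomp : (lift k v : FreeAlgebra k Y → T) ∘ ι k = v := by ext; simp
      rw [hcomp] at hp
      have hc := hv (hp.trans (map_zero _).symm)
      exact ⟨c, fun y => by simpa using DFunLike.congr_fun hc y,
        by rw [map_zero, zero_add, rightCombination_apply]⟩
    have hι (y : Y) : equivMonoidAlgebraFreeMonoid (ι k y) =
        MonoidAlgebra.single (FreeMonoid.of y) (1 : k) := by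
      simp [equivMonoidAlgebraFreeMonoid, MonoidAlgebra.of_apply]
    induction w using FreeMonoid.inductionOn' with
    | one =>
      intro p hp
      obtain ⟨c, -, rfl⟩ := peel p hp
      rw [Finsupp.sum, map_sum, MonoidAlgebra.coeff_sum, Finsupp.finsetSum_apply]
      refine Finset.sum_eq_zero fun y _ => ?_
      rw [map_mul, hι, MonoidAlgebra.coeff_single_mul_of_forall_mul_ne]
      intro u hu
      simpa using congrArg FreeMonoid.length hu
    | of_mul x w ih =>
      intro p hp
      obtain ⟨c, hc, rfl⟩ := peel p hp
      rw [Finsupp.sum, map_sum, MonoidAlgebra.coeff_sum, Finsupp.finsetSum_apply]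
      refine Finset.sum_eq_zero fun y _ => ?_
      rw [_root_.map_mul equivMonoidAlgebraFreeMonoid, hι]
      by_cases hy : y = x
      · subst hy
        rw [MonoidAlgebra.coeff_single_mul_eq_mul_coeff, ih _ (hc y), mul_zero]
        intro u _
        exact mul_right_inj _
      · apply MonoidAlgebra.coeff_single_mul_of_forall_mul_ne
        intro u hu
        have := congrArg FreeMonoid.toList hu
        simp at this
        exact hy this.1
  rw [injective_iff_map_eq_zero]
  intro p hp
  apply equivMonoidAlgebraFreeMonoid.injective
  rw [map_zero]
  ext w
  simpa using key w p hp

end FreeAlgebra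

namespace TensorAlgebra

open FreeAlgebra (rightCombination rightCombination_apply rightCombination_mul
  map_rightCombination)
open DirectSum

variable {k M : Type*} [Field k] [AddCommGroup M] [Module k M]

/-- The degree `n` part of the tensor algebra. -/
local notation "𝒯" => fun n : ℕ => LinearMap.range (ι k : M →ₗ[k] TensorAlgebra k M) ^ n

/-- The upper triangular representation `f ↦ !![f, ∂f; 0, ε f]` encoding the right derivative
along a linear form. -/
noncomputable def rightDerivHom (l : M →ₗ[k] k) :
    TensorAlgebra k M →ₐ[k] Matrix (Fin 2) (Fin 2) (TensorAlgebra k M) :=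
  lift k
    { toFun := fun m => !![ι k m, algebraMap k _ (l m); 0, 0]
      map_add' := fun a b => by ext i j; fin_cases i <;> fin_cases j <;> simp
      map_smul' := fun r a => by
        ext i j; fin_cases i <;> fin_cases j <;> simp [Algebra.smul_def] }

/-- The right derivative of the tensor algebra along a linear form: it strips the last letter
of each word and applies the form to it. -/
noncomputable def rightDeriv (l : M →ₗ[k] k) : TensorAlgebra k M →ₗ[k] TensorAlgebra k M where
  toFun f := rightDerivHom l f 0 1
  map_add' := by simp
  map_smul' := by simp

theorem rightDerivHom_eq (l : M →ₗ[k] k) (f : TensorAlgebra k M) :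
    rightDerivHom l f = !![f, rightDeriv l f; 0, algebraMap k _ (algebraMapInv f)] := by
  have h : rightDerivHom l f 0 0 = f ∧ rightDerivHom l f 1 0 = 0 ∧
      rightDerivHom l f 1 1 = algebraMap k _ (algebraMapInv f) := by
    induction f using TensorAlgebra.induction with
    | algebraMap r => simp [Matrix.algebraMap_matrix_apply]
    | ι m => simp [rightDerivHom, algebraMapInv]
    | mul a b ha hb => simp [Matrix.mul_apply, ha, hb]
    | add a b ha hb => simp [ha, hb]
  ext i j
  fin_cases i <;> fin_cases j <;> simp [h, rightDeriv]

theorem rightDeriv_mul (l : M →ₗ[k] k) (a b : TensorAlgebra k M) :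
    rightDeriv l (a * b) =
      a * rightDeriv l b + rightDeriv l a * algebraMap k _ (algebraMapInv b) := by
  change rightDerivHom l (a * b) 0 1 = _
  rw [map_mul, rightDerivHom_eq, rightDerivHom_eq]
  simp [Matrix.mul_apply]

@[simp]
theorem rightDeriv_algebraMap (l : M →ₗ[k] k) (r : k) :
    rightDeriv l (algebraMap k _ r) = 0 := by
  change rightDerivHom l (algebraMap k _ r) 0 1 = _
  simp [Matrix.algebraMap_matrix_apply]

@[simp]
theorem rightDeriv_ι (l : M →ₗ[k] k) (m : M) : rightDeriv l (ι k m) = algebraMap k _ (l m) := by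
  change rightDerivHom l _ 0 1 = _
  simp [rightDerivHom]

@[simp]
theorem algebraMapInv_ι (m : M) : algebraMapInv (ι k m) = 0 := by
  simp [algebraMapInv]

@[simp]
theorem algebraMapInv_algebraMap (r : k) :
    algebraMapInv (algebraMap k (TensorAlgebra k M) r) = r :=
  algebraMap_leftInverse M r

theorem eq_algebraMap_add_sum_rightDeriv {κ : Type*} [Fintype κ] (b : Module.Basis κ k M)
    (f : TensorAlgebra k M) :
    f = algebraMap k _ (algebraMapInv f) + ∑ j, rightDeriv (b.coord j) f * ι k (b j) := by
  induction f using TensorAlgebra.induction with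
  | algebraMap r => simp
  | ι m =>
    simp only [algebraMapInv_ι, map_zero, zero_add, rightDeriv_ι, ← Algebra.smul_def]
    conv_lhs => rw [← b.sum_repr m, map_sum]
    simp only [map_smul, Module.Basis.coord_apply]
  | mul f g hf hg =>
    have h : ∑ j, rightDeriv (b.coord j) (f * g) * ι k (b j) =
        f * ∑ j, rightDeriv (b.coord j) g * ι k (b j) +
        algebraMap k _ (algebraMapInv g) * ∑ j, rightDeriv (b.coord j) f * ι k (b j) := by
      rw [Finset.mul_sum, Finset.mul_sum, ← Finset.sum_add_distrib]
      refine Finset.sum_congr rfl fun j _ => ?_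
      rw [rightDeriv_mul, add_mul, mul_assoc, ← Algebra.commutes, mul_assoc]
    rw [h, ← sub_eq_of_eq_add' hf, ← sub_eq_of_eq_add' hg, map_mul, map_mul,
      mul_sub, mul_sub, ← Algebra.commutes (algebraMapInv g) f,
      ← Algebra.commutes (algebraMapInv g) (algebraMap k _ (algebraMapInv f))]
    abel
  | add f g hf hg =>
    nth_rw 1 [hf, hg]
    simp only [map_add, add_mul, Finset.sum_add_distrib]
    abel

theorem ι_mem_one (m : M) : ι k m ∈ 𝒯 1 := by
  simp

theorem decompose_zero_eq {κ : Type*} [Fintype κ] (b : Module.Basis κ k M)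
    (f : TensorAlgebra k M) :
    (decompose 𝒯 f 0 : TensorAlgebra k M) = algebraMap k _ (algebraMapInv f) := by
  conv_lhs => rw [eq_algebraMap_add_sum_rightDeriv b f]
  rw [decompose_add, decompose_sum, DirectSum.add_apply, DFinsupp.finsetSum_apply]
  rw [Submodule.coe_add, AddSubmonoidClass.coe_finsetSum,
    Finset.sum_eq_zero fun j _ =>
      coe_decompose_mul_of_right_mem_of_not_le 𝒯 (ι_mem_one (b j)) (by simp), add_zero]
  exact decompose_of_mem_same 𝒯 (SetLike.algebraMap_mem_graded 𝒯 _)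

/-- A set of augmentation-zero elements stable under right derivatives is zero. -/
theorem eq_zero_of_rightDeriv_stable {κ : Type*} [Fintype κ] (b : Module.Basis κ k M)
    (P : TensorAlgebra k M → Prop) (h0 : ∀ f, P f → algebraMapInv f = 0)
    (hd : ∀ j f, P f → P (rightDeriv (b.coord j) f)) (f : TensorAlgebra k M) (hf : P f) :
    f = 0 := by
  have key : ∀ n f, P f → (decompose 𝒯 f n : TensorAlgebra k M) = 0 := by
    intro n
    induction n with
    | zero => intro f hf; rw [decompose_zero_eq b, h0 f hf, map_zero]
    | succ n ih =>
      intro f hf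
      rw [eq_algebraMap_add_sum_rightDeriv b f, h0 f hf, map_zero, zero_add, decompose_sum,
        DFinsupp.finsetSum_apply, AddSubmonoidClass.coe_finsetSum]
      refine Finset.sum_eq_zero fun j _ => ?_
      rw [coe_decompose_mul_of_right_mem_of_le 𝒯 (ι_mem_one (b j)) (by simp),
        Nat.add_sub_cancel, ih _ (hd j f hf), zero_mul]
  apply (decompose 𝒯).injective
  rw [decompose_zero]
  ext n
  simpa using key n f hf

/-- The elements of positive degree `n` of a subalgebra of the tensor algebra. -/
def positivePart (A : Subalgebra k (TensorAlgebra k M)) (n : ℕ) : Set (TensorAlgebra k M) :=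
  {f | 0 < n ∧ f ∈ A ∧ f ∈ 𝒯 n}

/-- The right ideal of the tensor algebra generated by the homogeneous elements of a subalgebra
of positive degree less than `n`. -/
def lowerIdeal (A : Subalgebra k (TensorAlgebra k M)) (n : ℕ) : Submodule k (TensorAlgebra k M) :=
  Submodule.span k {z | ∃ m < n, ∃ a ∈ positivePart A m, ∃ f, a * f = z}

/-- Homogeneous elements of a subalgebra which are, in each degree, linearly independent modulo
the right ideal generated by the lower degrees are right independent. -/
theorem rightCombination_injective {κ Y : Type*} [Fintype κ] (b : Module.Basis κ k M)
    (A : Subalgebra k (TensorAlgebra k M)) (deg : Y → ℕ) (v : Y → TensorAlgebra k M)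
    (hv : ∀ y, v y ∈ positivePart A (deg y))
    (hind : ∀ n, LinearIndepOn k (fun y => (lowerIdeal A n).mkQ (v y)) {y | deg y = n}) :
    Function.Injective (rightCombination k v) := by
  classical
  have h0 : ∀ c, rightCombination k v c = 0 → ∀ y, algebraMapInv (c y) = 0 := by
    intro c hc y
    by_cases hy : y ∈ c.support
    swap
    · rw [Finsupp.notMem_support_iff.mp hy, map_zero]
    have hmem : ∑ z ∈ c.support with deg z = deg y, algebraMapInv (c z) • v z ∈
        lowerIdeal A (deg y) := by
      have hcomp : ∑ z ∈ c.support,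
          (decompose 𝒯 (v z * c z) (deg y) : TensorAlgebra k M) = 0 := by
        rw [rightCombination_apply, Finsupp.sum] at hc
        rw [← AddSubmonoidClass.coe_finsetSum, ← DFinsupp.finsetSum_apply, ← decompose_sum, hc,
          decompose_zero]
        rfl
      rw [← Finset.sum_filter_add_sum_filter_not _ (fun z => deg z = deg y),
        add_eq_zero_iff_eq_neg] at hcomp
      have hsame : ∑ z ∈ c.support with deg z = deg y, algebraMapInv (c z) • v z =
          ∑ z ∈ c.support with deg z = deg y,
            (decompose 𝒯 (v z * c z) (deg y) : TensorAlgebra k M) := by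
        refine Finset.sum_congr rfl fun z hz => ?_
        rw [coe_decompose_mul_of_left_mem_of_le 𝒯 (hv z).2.2 (Finset.mem_filter.mp hz).2.le,
          (Finset.mem_filter.mp hz).2, Nat.sub_self, decompose_zero_eq b, Algebra.smul_def,
          Algebra.commutes]
      rw [hsame, hcomp]
      refine neg_mem (sum_mem fun z hz => ?_)
      rcases lt_or_gt_of_ne (Finset.mem_filter.mp hz).2 with h | h
      · rw [coe_decompose_mul_of_left_mem_of_le 𝒯 (hv z).2.2 h.le]
        exact Submodule.subset_span ⟨_, h, _, hv z, _, rfl⟩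
      · rw [coe_decompose_mul_of_left_mem_of_not_le 𝒯 (hv z).2.2 h.not_ge]
        exact zero_mem _
    refine linearIndepOn_iff'.mp (hind (deg y)) (c.support.filter fun z => deg z = deg y)
      (fun z => algebraMapInv (c z)) (fun z hz => ?_) ?_ y (by simp [hy])
    · exact (Finset.mem_filter.mp hz).2
    · rw [← (Submodule.Quotient.mk_eq_zero _).mpr hmem, ← Submodule.mkQ_apply, map_sum]
      simp only [map_smul]
  rw [injective_iff_map_eq_zero]
  intro c hc
  ext y
  refine eq_zero_of_rightDeriv_stable b
    (fun f => ∃ c : Y →₀ TensorAlgebra k M, rightCombination k v c = 0 ∧ c y = f) ?_ ?_ _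
    ⟨c, hc, rfl⟩
  · rintro _ ⟨c, hc, rfl⟩
    exact h0 c hc y
  · rintro j _ ⟨c, hc, rfl⟩
    refine ⟨c.mapRange (rightDeriv (b.coord j)) (map_zero _), ?_, by simp⟩
    have := congrArg (rightDeriv (b.coord j)) hc
    rw [rightCombination_apply, Finsupp.sum, map_sum, map_zero] at this
    rw [rightCombination_apply, Finsupp.sum_mapRange_index (by simp), Finsupp.sum, ← this]
    refine Finset.sum_congr rfl fun z _ => ?_
    rw [rightDeriv_mul, h0 c hc z, map_zero, mul_zero, add_zero]

/-- Homogeneous elements of a subalgebra which span, in each degree, modulo the right ideal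
generated by the lower degrees, generate all positive parts as a right ideal. -/
theorem mem_range_rightCombination {Y : Type*} (A : Subalgebra k (TensorAlgebra k M))
    (deg : Y → ℕ) (v : Y → TensorAlgebra k M)
    (hspan : ∀ n, positivePart A n ⊆
      (Submodule.span k (v '' {y | deg y = n}) ⊔ lowerIdeal A n : Submodule k _))
    {n : ℕ} {a : TensorAlgebra k M} (ha : a ∈ positivePart A n) :
    a ∈ LinearMap.range (rightCombination k v) := by
  induction n using Nat.strong_induction_on generalizing a with
  | _ n ih =>
    refine (sup_le ?_ ?_ : _ ≤ LinearMap.range (rightCombination k v)) (hspan n ha)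
    · rw [Submodule.span_le]
      rintro _ ⟨y, -, rfl⟩
      exact ⟨Finsupp.single y 1, by simp⟩
    · rw [lowerIdeal, Submodule.span_le]
      rintro _ ⟨m, hm, a, ha, f, rfl⟩
      obtain ⟨c, rfl⟩ := ih m hm ha
      exact ⟨_, (rightCombination_mul v c f).symm⟩

/-- Degree-preserving endomorphisms commute with taking homogeneous components. -/
theorem map_decompose (φ : TensorAlgebra k M →ₐ[k] TensorAlgebra k M)
    (hφ : ∀ n, ∀ f ∈ 𝒯 n, φ f ∈ 𝒯 n) (f : TensorAlgebra k M) (n : ℕ) :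
    φ (decompose 𝒯 f n) = decompose 𝒯 (φ f) n := by
  classical
  conv_rhs => rw [← sum_support_decompose 𝒯 f, map_sum, decompose_sum, DFinsupp.finsetSum_apply,
    AddSubmonoidClass.coe_finsetSum]
  rw [Finset.sum_eq_single n]
  · rw [decompose_of_mem_same 𝒯 (hφ n _ (SetLike.coe_mem _))]
  · intro m _ hm
    rw [decompose_of_mem_ne 𝒯 (hφ m _ (SetLike.coe_mem _)) hm]
  · intro hn
    rw [DFinsupp.notMem_support_iff.mp hn]
    simp

/-- The fixed subalgebra of a family of degree-preserving endomorphisms is generated by any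
right independent family spanning its positive part as a right ideal. -/
theorem adjoin_range_eq {κ Γ Y : Type*} [Fintype κ] (b : Module.Basis κ k M)
    (φ : Γ → TensorAlgebra k M →ₐ[k] TensorAlgebra k M)
    (hφ : ∀ γ n, ∀ f ∈ 𝒯 n, φ γ f ∈ 𝒯 n)
    (A : Subalgebra k (TensorAlgebra k M)) (hA : ∀ f, f ∈ A ↔ ∀ γ, φ γ f = f)
    (deg : Y → ℕ) (v : Y → TensorAlgebra k M)
    (hv : ∀ y, v y ∈ positivePart A (deg y))
    (hinj : Function.Injective (rightCombination k v))
    (hsurj : ∀ n, positivePart A n ⊆ LinearMap.range (rightCombination k v)) :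
    Algebra.adjoin k (Set.range v) = A := by
  classical
  have hcomp : ∀ f ∈ A, ∀ n, (decompose 𝒯 f n : TensorAlgebra k M) ∈ A := by
    intro f hf n
    rw [hA] at hf ⊢
    intro γ
    rw [map_decompose _ (hφ γ), hf γ]
  have hhom : ∀ n, ∀ a ∈ A, a ∈ 𝒯 n → a ∈ Algebra.adjoin k (Set.range v) := by
    intro n
    induction n using Nat.strong_induction_on with
    | _ n ih =>
      intro a ha hn
      rcases Nat.eq_zero_or_pos n with rfl | hpos
      · rw [← decompose_of_mem_same 𝒯 hn, decompose_zero_eq b]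
        exact Subalgebra.algebraMap_mem _ _
      obtain ⟨c, rfl⟩ := hsurj n ⟨hpos, ha, hn⟩
      have hc : ∀ y, c y ∈ A := by
        intro y
        rw [hA] at ha ⊢
        intro γ
        have h := ha γ
        have hfix : φ γ ∘ v = v := funext fun z => (hA _).mp (hv z).2.1 γ
        rw [map_rightCombination, hfix] at h
        simpa using DFunLike.congr_fun (hinj h) y
      rw [← decompose_of_mem_same 𝒯 hn, rightCombination_apply, Finsupp.sum, decompose_sum,
        DFinsupp.finsetSum_apply, AddSubmonoidClass.coe_finsetSum]
      refine sum_mem fun y _ => ?_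
      by_cases hy : deg y ≤ n
      · rw [coe_decompose_mul_of_left_mem_of_le 𝒯 (hv y).2.2 hy]
        refine mul_mem (Algebra.subset_adjoin ⟨y, rfl⟩) (ih (n - deg y) ?_ _ (hcomp _ (hc y) _)
          (SetLike.coe_mem _))
        have := (hv y).1
        omega
      · rw [coe_decompose_mul_of_left_mem_of_not_le 𝒯 (hv y).2.2 hy]
        exact zero_mem _
  apply le_antisymm
  · rw [Algebra.adjoin_le_iff]
    rintro _ ⟨y, rfl⟩
    exact (hv y).2.1
  · intro a ha
    rw [← sum_support_decompose 𝒯 a]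
    exact sum_mem fun n _ => hhom n _ (hcomp a ha n) (SetLike.coe_mem _)

/-- The fixed subalgebra of a family of degree-preserving endomorphisms of the tensor algebra of
a finite-dimensional vector space is free. -/
theorem exists_algEquiv_freeAlgebra_of_fixed {κ Γ : Type*} [Fintype κ] (b : Module.Basis κ k M)
    (φ : Γ → TensorAlgebra k M →ₐ[k] TensorAlgebra k M)
    (hφ : ∀ γ n, ∀ f ∈ 𝒯 n, φ γ f ∈ 𝒯 n)
    (A : Subalgebra k (TensorAlgebra k M)) (hA : ∀ f, f ∈ A ↔ ∀ γ, φ γ f = f) :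
    ∃ Y : Set (ℕ × TensorAlgebra k M), Nonempty (A ≃ₐ[k] FreeAlgebra k Y) := by
  have hex := fun n => exists_linearIndepOn_extension (v := (lowerIdeal A n).mkQ)
    (linearIndepOn_empty k _) (Set.empty_subset (positivePart A n))
  choose B hBsub _ hBspan hBind using hex
  let Y : Set (ℕ × TensorAlgebra k M) := {p | p.2 ∈ B p.1}
  let deg : Y → ℕ := fun y => y.1.1
  let v : Y → TensorAlgebra k M := fun y => y.1.2
  have hv : ∀ y, v y ∈ positivePart A (deg y) := fun y => hBsub _ y.2
  have hinj : Function.Injective (rightCombination k v) := by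
    refine rightCombination_injective b A deg v hv fun n => ?_
    have hmem : ∀ y : {y : Y | deg y = n}, v y ∈ B n := by
      rintro ⟨⟨⟨m, f⟩, hf⟩, rfl⟩
      exact hf
    refine (hBind n).comp (fun y : {y : Y | deg y = n} => ⟨v y, hmem y⟩) ?_
    rintro ⟨⟨⟨m, f⟩, hf⟩, hm⟩ ⟨⟨⟨m', f'⟩, hf'⟩, hm'⟩ h
    obtain rfl : m = n := hm
    obtain rfl : m' = m := hm'
    obtain rfl : f = f' := congrArg Subtype.val h
    rfl
  have hsurj : ∀ n, positivePart A n ⊆ LinearMap.range (rightCombination k v) := by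
    intro n a ha
    refine mem_range_rightCombination A deg v (fun n a ha => ?_) ha
    have h := hBspan n ⟨a, ha, rfl⟩
    rw [← Submodule.map_span] at h
    obtain ⟨x, hx, hxa⟩ := h
    have hB : B n ⊆ v '' {y | deg y = n} := fun f hf => ⟨⟨(n, f), hf⟩, rfl, rfl⟩
    rw [← add_sub_cancel x a]
    exact Submodule.add_mem_sup (Submodule.span_mono hB hx)
      ((Submodule.Quotient.eq _).mp hxa.symm)
  have hadj := adjoin_range_eq b φ hφ A hA deg v hv hinj hsurj
  have hlift := FreeAlgebra.lift_injective_of_rightCombination_injective v algebraMapInv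
    (fun y => by
      have hy := hv y
      have h := decompose_zero_eq b (v y)
      rw [decompose_of_mem_ne 𝒯 hy.2.2 hy.1.ne'] at h
      exact (algebraMap_leftInverse M).injective (h.symm.trans (map_zero _).symm)) hinj
  refine ⟨Y, ⟨((AlgEquiv.ofInjective _ hlift).trans (Subalgebra.equivOfEq _ _ ?_)).symm⟩⟩
  rw [← hadj, Algebra.adjoin_range_eq_range_freeAlgebra_lift]

end TensorAlgebra

theorem glAction_mem_pow (d : ℕ) (g : Matrix.GeneralLinearGroup (Fin d) ℂ) (n : ℕ)
    (f : TensorAlgebra ℂ (Fin d → ℂ))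
    (hf : f ∈ LinearMap.range (TensorAlgebra.ι ℂ : (Fin d → ℂ) →ₗ[ℂ] _) ^ n) :
    glAction d g f ∈ LinearMap.range (TensorAlgebra.ι ℂ : (Fin d → ℂ) →ₗ[ℂ] _) ^ n := by
  have h := Submodule.mem_map_of_mem (f := (glAction d g).toLinearMap) hf
  rw [Submodule.map_pow] at h
  refine (pow_le_pow_left' ?_ n : _ ≤ LinearMap.range (TensorAlgebra.ι ℂ) ^ n) h
  rintro _ ⟨_, ⟨x, rfl⟩, rfl⟩
  exact ⟨Matrix.mulVecLin (g : Matrix (Fin d) (Fin d) ℂ) x, by simp [glAction]⟩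

/-- **Lane; Kharchenko.** For every subgroup `G` of `GL_d(ℂ)` acting on the free associative
algebra `ℂ⟨x₁,…,x_d⟩` by algebra automorphisms extending the natural linear action on the span
of the generators, the algebra of invariants is a free associative algebra: it is isomorphic as
a `ℂ`-algebra to the free associative algebra `ℂ⟨Y⟩` on some set `Y`. -/
theorem lane_kharchenko_invariants_free (d : ℕ) (hd : 1 ≤ d)
    (G : Subgroup (Matrix.GeneralLinearGroup (Fin d) ℂ)) :
    ∃ Y : Type, Nonempty (glInvariants d G ≃ₐ[ℂ] FreeAlgebra ℂ Y) := by
  obtain ⟨Y, hY⟩ := TensorAlgebra.exists_algEquiv_freeAlgebra_of_fixed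
    (Pi.basisFun ℂ (Fin d)) (fun g : G => glAction d g)
    (fun g n f hf => glAction_mem_pow d g n f hf) (glInvariants d G)
    (fun f => ⟨fun hf g => hf g g.2, fun hf g hg => hf ⟨g, hg⟩⟩)
  exact ⟨Y, hY⟩
end

section
/- (Almkvist–Dicks–Formanek) Let SL₂(ℂ) act naturally on V = ℂ² and diagonally on the tensor powers V^{⊗m} by g ↦ g^{⊗m}. Then the subspace of SL₂(ℂ)-invariant tensors in V^{⊗m} is zero when m is odd, and for every k ≥ 0 the space of SL₂(ℂ)-invariant tensors in V^{⊗2k} has dimension equal to the k-th Catalan number C_k = binom(2k,k)/(k+1). Equivalently, the Hilbert series of the invariant algebra ℂ⟨x_1,x_2⟩^{SL₂} is H(t) = (1 − √(1 − 4t²))/(2t²), with homogeneous invariants only in even degrees and dim of the degree-2(n−1) component equal to c_n = (1/n)·binom(2n−2, n−1). -/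
open scoped TensorProduct

/-- The diagonal action `g ↦ g^{⊗m}` of `g ∈ SL₂(ℂ)` on the `m`-th tensor power of `V = ℂ²`. -/
noncomputable def sl2TensorPowerAction (m : ℕ) (g : Matrix.SpecialLinearGroup (Fin 2) ℂ) :
    TensorPower ℂ m (Fin 2 → ℂ) →ₗ[ℂ] TensorPower ℂ m (Fin 2 → ℂ) :=
  PiTensorProduct.map fun _ => Matrix.mulVecLin (g : Matrix (Fin 2) (Fin 2) ℂ)

/-- The subspace of `SL₂(ℂ)`-invariant tensors in the `m`-th tensor power of `ℂ²`. -/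
noncomputable def sl2Invariants (m : ℕ) : Submodule ℂ (TensorPower ℂ m (Fin 2 → ℂ)) where
  carrier := {x | ∀ g : Matrix.SpecialLinearGroup (Fin 2) ℂ, sl2TensorPowerAction m g x = x}
  add_mem' := fun ha hb g => by rw [map_add, ha g, hb g]
  zero_mem' := fun g => map_zero _
  smul_mem' := fun c x hx g => by rw [map_smul, hx g]

section TensorPower

open PiTensorProduct

variable {ι R M : Type*} [DecidableEq ι] [CommRing R] [AddCommGroup M] [Module R M]

/-- The endomorphism of a tensor power acting as `X` on the factor `i`, and as the identity on all
the other factors. -/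
noncomputable def factorMap (i : ι) :
    Module.End R M →ₗ[R] Module.End R (⨂[R] _ : ι, M) :=
  (mapMultilinear R (fun _ : ι => M) (fun _ => M)).toLinearMap (fun _ => 1) i

theorem factorMap_eq_map (i : ι) (X : Module.End R M) :
    factorMap i X = PiTensorProduct.map (Pi.mulSingle i X) := rfl

theorem factorMap_eq_mapMonoidHom (i : ι) (X : Module.End R M) :
    factorMap i X = mapMonoidHom (Pi.mulSingle i X) := rfl

theorem factorMap_mul (i : ι) (X Y : Module.End R M) :
    factorMap i (X * Y) = factorMap i X * factorMap i Y := by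
  simp only [factorMap_eq_mapMonoidHom, Pi.mulSingle_mul, map_mul]

theorem commute_factorMap {i j : ι} (h : i ≠ j) (X Y : Module.End R M) :
    Commute (factorMap i X) (factorMap j Y) := by
  simp only [factorMap_eq_mapMonoidHom]
  exact (Pi.mulSingle_commute (f := fun _ : ι => Module.End R M) h X Y).map mapMonoidHom

theorem factorMap_tprod (i : ι) (X : Module.End R M) (v : ι → M) :
    factorMap i X (tprod R v) = tprod R (Function.update v i (X (v i))) := by
  rw [factorMap_eq_map, map_tprod]
  congr 1
  ext j
  rcases eq_or_ne j i with rfl | h <;> simp [*]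

theorem isNilpotent_sum_factorMap {X : Module.End R M} (h : X * X = 0) (s : Finset ι) :
    IsNilpotent (∑ i ∈ s, factorMap i X) := by
  refine Commute.isNilpotent_sum
    (fun i _ => ⟨2, by rw [sq, ← factorMap_mul, h, map_zero]⟩) fun i j _ _ => ?_
  rcases eq_or_ne i j with rfl | hij
  · exact Commute.refl _
  · exact commute_factorMap hij X X

theorem exp_factorMap [Module ℚ (Module.End R (⨂[R] _ : ι, M))] {X : Module.End R M} (h : X * X = 0)
    (i : ι) :
    IsNilpotent.exp (factorMap i X) = factorMap i (1 + X) := by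
  have h0 : (factorMap i X) ^ 2 = 0 := by rw [sq, ← factorMap_mul, h, map_zero]
  have h1 : factorMap i (1 : Module.End R M) = 1 := by
    rw [factorMap_eq_mapMonoidHom, Pi.mulSingle_one, map_one]
  simp [IsNilpotent.exp_eq_sum h0, Finset.sum_range_succ, map_add, h1]

variable [Fintype ι]

/-- The action of an endomorphism on a tensor power by the Leibniz rule, that is, the sum of its
actions on the individual factors. -/
noncomputable def leibnizMap (ι : Type*) [Fintype ι] [DecidableEq ι] :
    Module.End R M →ₗ[R] Module.End R (⨂[R] _ : ι, M) :=
  ∑ i, factorMap i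

theorem leibnizMap_apply (X : Module.End R M) :
    leibnizMap ι X = ∑ i, factorMap i X := by
  simp [leibnizMap]

theorem leibnizMap_lie (X Y : Module.End R M) :
    leibnizMap ι ⁅X, Y⁆ = ⁅leibnizMap ι X, leibnizMap ι Y⁆ := by
  have h : ∑ i, ∑ j, factorMap (ι := ι) j Y * factorMap i X =
      ∑ i, (factorMap i Y * factorMap i X +
        (∑ j, factorMap i X * factorMap j Y - factorMap i X * factorMap i Y)) := by
    refine Finset.sum_congr rfl fun i _ => ?_
    rw [← Finset.add_sum_erase _ _ (Finset.mem_univ i),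
      ← Finset.add_sum_erase _ (fun j => factorMap i X * factorMap j Y) (Finset.mem_univ i),
      add_sub_cancel_left]
    congr 1
    exact Finset.sum_congr rfl fun j hj => commute_factorMap (Finset.ne_of_mem_erase hj) Y X
  simp only [leibnizMap_apply, Ring.lie_def, map_sub, factorMap_mul, Finset.sum_mul_sum]
  rw [Finset.sum_comm (γ := ι) (f := fun i j => factorMap i Y * factorMap j X), h]
  simp only [Finset.sum_add_distrib, Finset.sum_sub_distrib]
  abel

variable [Module ℚ (Module.End R (⨂[R] _ : ι, M))]

theorem exp_leibnizMap {X : Module.End R M} (h : X * X = 0) :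
    IsNilpotent.exp (leibnizMap ι X) = PiTensorProduct.map fun _ => 1 + X := by
  have key (s : Finset ι) : IsNilpotent.exp (∑ i ∈ s, factorMap i X) =
      mapMonoidHom fun i => if i ∈ s then 1 + X else 1 := by
    induction s using Finset.induction_on with
    | empty => simp
    | insert i s hi ih =>
      rw [Finset.sum_insert hi, IsNilpotent.exp_add_of_commute
        (Commute.sum_right _ _ _ fun j hj =>
          commute_factorMap (ne_of_mem_of_not_mem hj hi).symm X X)
        ⟨2, by rw [sq, ← factorMap_mul, h, map_zero]⟩ (isNilpotent_sum_factorMap h s),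
        ih, exp_factorMap h, factorMap_eq_mapMonoidHom, ← map_mul]
      congr 1
      ext1 j
      rcases eq_or_ne j i with rfl | hj <;> simp [*]
  simpa [leibnizMap_apply] using key Finset.univ

theorem IsNilpotent.exp_apply_eq_self_iff {N : Type*} [AddCommGroup N] [Module R N]
    [Module ℚ (Module.End R N)] {A : Module.End R N} (hA : IsNilpotent A) (x : N) :
    IsNilpotent.exp A x = x ↔ A x = 0 := by
  obtain ⟨n, hn⟩ := hA
  have hn' : A ^ (n + 2) = 0 := pow_eq_zero_of_le (by omega) hn
  rw [IsNilpotent.exp_eq_sum hn']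
  constructor
  · intro h
    set B : Module.End R N :=
      ∑ i ∈ Finset.range n, ((i + 2).factorial : ℚ)⁻¹ • A ^ (i + 1) with hB
    have hAB : (1 + B) * A = ∑ i ∈ Finset.range (n + 2), (i.factorial : ℚ)⁻¹ • A ^ i - 1 := by
      rw [Finset.sum_range_succ', Finset.sum_range_succ', hB, add_mul, Finset.sum_mul]
      simp only [smul_mul_assoc, ← _root_.pow_succ]
      simpa using add_comm _ _
    have hBnil : IsNilpotent B := Commute.isNilpotent_sum
      (fun i _ => (IsNilpotent.pow_succ i ⟨n, hn⟩).smul _)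
      fun i j _ _ => ((Commute.pow_pow_self A (i + 1) (j + 1)).smul_left _).smul_right _
    obtain ⟨u, hu⟩ := hBnil.isUnit_one_add
    have h2 : (1 + B) (A x) = 0 := by
      rw [← Module.End.mul_apply, hAB, LinearMap.sub_apply, h, Module.End.one_apply, sub_self]
    have h3 := congrArg (fun y => (↑u⁻¹ : Module.End R N) y) h2
    simpa only [← hu, ← Module.End.mul_apply, Units.inv_mul, Module.End.one_apply, map_zero,
      ← mul_assoc, one_mul] using h3
  · intro h
    rw [Finset.sum_range_succ']
    have h' (i : ℕ) (c : ℚ) : (c • A ^ (i + 1)) x = 0 := by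
      rw [_root_.pow_succ, ← smul_mul_assoc, Module.End.mul_apply, h, map_zero]
    simp [LinearMap.sum_apply, h']

theorem map_one_add_apply_eq_self_iff {X : Module.End R M} (h : X * X = 0)
    (x : ⨂[R] _ : ι, M) :
    PiTensorProduct.map (fun _ => 1 + X) x = x ↔ leibnizMap ι X x = 0 := by
  rw [← exp_leibnizMap h, IsNilpotent.exp_apply_eq_self_iff]
  simpa [leibnizMap_apply] using isNilpotent_sum_factorMap h Finset.univ

end TensorPower

section LeibnizBasis

open PiTensorProduct

variable {ι κ R M : Type*} [Fintype ι] [DecidableEq ι] [CommRing R] [AddCommGroup M]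
  [Module R M]

theorem leibnizMap_piTensorProduct_basis (b : Module.Basis κ R M) {X : Module.End R M} {c : κ → R}
    (h : ∀ k, X (b k) = c k • b k) (p : ι → κ) :
    leibnizMap ι X (Basis.piTensorProduct (fun _ => b) p) =
      (∑ i, c (p i)) • Basis.piTensorProduct (fun _ => b) p := by
  simp only [leibnizMap_apply, LinearMap.sum_apply, Basis.piTensorProduct_apply, factorMap_tprod, h,
    MultilinearMap.map_update_smul, Function.update_eq_self, Finset.sum_smul]

variable [Fintype κ] [DecidableEq κ]

theorem toMatrix_factorMap (b : Module.Basis κ R M) (i : ι) (X : Module.End R M) (p q : ι → κ) :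
    LinearMap.toMatrix (Basis.piTensorProduct fun _ : ι => b) (Basis.piTensorProduct fun _ => b)
      (factorMap i X) p q = ∏ j, (Pi.mulSingle i (LinearMap.toMatrix b b X) : ι → _) j (p j) (q j) := by
  rw [LinearMap.toMatrix_apply, Basis.piTensorProduct_apply, factorMap_tprod,
    Basis.piTensorProduct_repr_tprod_apply]
  refine Finset.prod_congr rfl fun j _ => ?_
  rcases eq_or_ne j i with rfl | h
  · simp [LinearMap.toMatrix_apply]
  · simp [h, Matrix.one_apply, Finsupp.single_apply, eq_comm]

theorem toMatrix_leibnizMap_conjTranspose [StarRing R] (b : Module.Basis κ R M)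
    {X Y : Module.End R M} (h : (LinearMap.toMatrix b b X).conjTranspose = LinearMap.toMatrix b b Y) :
    (LinearMap.toMatrix (Basis.piTensorProduct fun _ : ι => b) (Basis.piTensorProduct fun _ => b)
      (leibnizMap ι X)).conjTranspose =
    LinearMap.toMatrix (Basis.piTensorProduct fun _ : ι => b) (Basis.piTensorProduct fun _ => b)
      (leibnizMap ι Y) := by
  ext p q
  simp only [Matrix.conjTranspose_apply, leibnizMap_apply, map_sum, Matrix.sum_apply, star_sum,
    toMatrix_factorMap, star_prod, ← h]
  refine Finset.sum_congr rfl fun i _ => Finset.prod_congr rfl fun j _ => ?_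
  rcases eq_or_ne j i with rfl | hj
  · simp
  · by_cases hpq : p j = q j <;> simp [hj, hpq, Ne.symm]

end LeibnizBasis

section LinearAlgebra

variable {K V ι : Type*} [Field K] [AddCommGroup V] [Module K V]

theorem Module.End.eigenspace_eq_span_of_basis (b : Module.Basis ι K V) {T : Module.End K V}
    {c : ι → K} (h : ∀ i, T (b i) = c i • b i) (μ : K) :
    T.eigenspace μ = Submodule.span K (b '' {i | c i = μ}) := by
  have hrepr (x : V) (i : ι) : b.repr (T x) i = c i * b.repr x i := by
    have : (Finsupp.lapply i ∘ₗ b.repr.toLinearMap ∘ₗ T : V →ₗ[K] K) =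
        c i • (Finsupp.lapply i ∘ₗ b.repr.toLinearMap) := by
      refine b.ext fun j => ?_
      by_cases hij : j = i
      · subst hij; simp [h]
      · simp [h, hij]
    simpa using LinearMap.congr_fun this x
  ext x
  rw [Module.End.mem_eigenspace_iff, b.mem_span_image, ← b.repr.injective.eq_iff, Finsupp.ext_iff]
  simp only [hrepr, map_smul, Finsupp.smul_apply, smul_eq_mul, mul_eq_mul_right_iff, Set.subset_def,
    Finset.mem_coe, Finsupp.mem_support_iff, Set.mem_ofPred_eq]
  exact forall_congr' fun i => by tauto

theorem Module.End.finrank_eigenspace_of_basis [Fintype ι] [DecidableEq K] (b : Module.Basis ι K V)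
    {T : Module.End K V} {c : ι → K} (h : ∀ i, T (b i) = c i • b i) (μ : K) :
    Module.finrank K (T.eigenspace μ) = (Finset.univ.filter fun i => c i = μ).card := by
  rw [eigenspace_eq_span_of_basis b h, Set.image_eq_range]
  exact (finrank_span_eq_card (b.linearIndependent.comp _ Subtype.val_injective)).trans
    (Fintype.card_subtype _)

end LinearAlgebra

section Sl2Action

open scoped ComplexOrder

variable {V ι : Type*} [AddCommGroup V] [Module ℂ V] [Fintype ι] [DecidableEq ι]
  {b : Module.Basis ι ℂ V} {E F H : Module.End ℂ V}

theorem LinearMap.apply_eq_zero_of_adjoint_apply_eq_zero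
    (hEF : (LinearMap.toMatrix b b E).conjTranspose = LinearMap.toMatrix b b F) {x : V}
    (h : E (F x) = 0) : F x = 0 := by
  apply b.equivFun.injective
  have h1 := congrArg b.equivFun h
  simp only [map_zero, b.equivFun_apply, ← LinearMap.toMatrix_mulVec_repr b b] at h1 ⊢
  rw [← hEF, Matrix.mulVec_mulVec, Finsupp.coe_zero,
    Matrix.self_mul_conjTranspose_mulVec_eq_zero] at h1
  rw [← hEF, h1, Finsupp.coe_zero]

theorem LinearMap.eq_zero_of_adjoint_apply_eq_neg_smul
    (hEF : (LinearMap.toMatrix b b E).conjTranspose = LinearMap.toMatrix b b F) {x : V} {r : ℝ}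
    (hr : 0 < r) (h : F (E x) = -(r : ℂ) • x) : x = 0 := by
  apply b.equivFun.injective
  have h1 := congrArg (fun y => star (b.equivFun x) ⬝ᵥ b.equivFun y) h
  simp only [map_zero, map_smul] at h1 ⊢
  have h2 : star (b.equivFun x) ⬝ᵥ b.equivFun (F (E x)) =
      star (b.equivFun (E x)) ⬝ᵥ b.equivFun (E x) := by
    simp only [b.equivFun_apply, ← LinearMap.toMatrix_mulVec_repr b b, ← hEF]
    rw [Matrix.star_mulVec, Matrix.dotProduct_mulVec]
  rw [h2, dotProduct_smul, smul_eq_mul, neg_mul] at h1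
  have h3 := dotProduct_star_self_nonneg (b.equivFun (E x))
  have h4 := dotProduct_star_self_nonneg (b.equivFun x)
  rw [h1] at h3
  have hr' : (0 : ℂ) < r := by exact_mod_cast hr
  rw [← dotProduct_star_self_eq_zero]
  have h5 := mul_nonneg hr'.le h4
  have h6 := le_antisymm (neg_nonneg.1 h3) h5
  exact (mul_eq_zero.1 h6).resolve_left hr'.ne'

theorem Module.End.ker_inf_ker_eq_of_lie
    (hEF : (LinearMap.toMatrix b b E).conjTranspose = LinearMap.toMatrix b b F)
    (hH : ⁅E, F⁆ = H) :
    LinearMap.ker E ⊓ LinearMap.ker F = LinearMap.ker E ⊓ H.eigenspace 0 := by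
  ext x
  simp only [Submodule.mem_inf, LinearMap.mem_ker, Module.End.mem_eigenspace_iff, zero_smul, ← hH,
    Ring.lie_def, LinearMap.sub_apply, Module.End.mul_apply]
  refine and_congr_right fun hE => ⟨fun hF => by simp [hE, hF], fun h => ?_⟩
  exact LinearMap.apply_eq_zero_of_adjoint_apply_eq_zero hEF (by simpa [hE] using h)

theorem Module.End.finrank_ker_inf_eigenspace_zero
    (hEF : (LinearMap.toMatrix b b E).conjTranspose = LinearMap.toMatrix b b F)
    (hH : ⁅E, F⁆ = H) (hHE : ⁅H, E⁆ = (2 : ℂ) • E) (hHF : ⁅H, F⁆ = -(2 : ℂ) • F) :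
    Module.finrank ℂ ↥(LinearMap.ker E ⊓ H.eigenspace 0) + Module.finrank ℂ (H.eigenspace 2) =
      Module.finrank ℂ (H.eigenspace 0) := by
  have : FiniteDimensional ℂ V := b.finiteDimensional_of_finite
  have hHE' (x : V) : H (E x) = E (H x) + (2 : ℂ) • E x := by
    have := LinearMap.congr_fun hHE x
    simp only [Ring.lie_def, LinearMap.sub_apply, mul_apply, LinearMap.smul_apply] at this
    rw [← this]; abel
  have hHF' (x : V) : H (F x) = F (H x) - (2 : ℂ) • F x := by
    have := LinearMap.congr_fun hHF x
    simp only [Ring.lie_def, LinearMap.sub_apply, mul_apply, LinearMap.smul_apply] at this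
    rw [sub_eq_add_neg, ← neg_smul, ← this]; abel
  have hE : ∀ x ∈ H.eigenspace 0, E x ∈ H.eigenspace 2 := fun x hx => by
    rw [mem_eigenspace_iff] at *
    simp [hHE', hx]
  have hF : ∀ x ∈ H.eigenspace 2, F x ∈ H.eigenspace 0 := fun x hx => by
    rw [mem_eigenspace_iff] at *
    simp [hHF', hx]
  have hinj : Function.Injective (E.restrict hE ∘ₗ F.restrict hF) := by
    rw [← LinearMap.ker_eq_bot, LinearMap.ker_eq_bot']
    rintro ⟨x, hx⟩ h
    have hEFx : E (F x) = 0 := congrArg Subtype.val h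
    have hHx := LinearMap.congr_fun hH x
    rw [mem_eigenspace_iff] at hx
    rw [Ring.lie_def, LinearMap.sub_apply, mul_apply, mul_apply, hEFx, hx, zero_sub] at hHx
    rw [Submodule.mk_eq_zero]
    refine LinearMap.eq_zero_of_adjoint_apply_eq_neg_smul hEF two_pos ?_
    rw [← neg_neg (F (E x)), hHx]
    simp
  have hsurj : Function.Surjective (E.restrict hE) :=
    Function.Surjective.of_comp (LinearMap.surjective_of_injective hinj)
  rw [← LinearMap.finrank_range_add_finrank_ker (E.restrict hE), LinearMap.range_eq_top.2 hsurj,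
    finrank_top, add_comm, LinearMap.ker_restrict]
  congr 1
  rw [inf_comm, ← Submodule.map_comap_subtype]
  exact Submodule.finrank_map_subtype_eq _ _

end Sl2Action

section Invariants

theorem Matrix.SpecialLinearGroup.submonoid_eq_top_of_transvection_mem {K : Type*} [Field K]
    {S : Submonoid (Matrix.SpecialLinearGroup (Fin 2) K)}
    (hU : ∀ g : Matrix.SpecialLinearGroup (Fin 2) K, ∀ t, g.1 = !![1, t; 0, 1] → g ∈ S)
    (hL : ∀ g : Matrix.SpecialLinearGroup (Fin 2) K, ∀ t, g.1 = !![1, 0; t, 1] → g ∈ S) :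
    S = ⊤ := by
  let u (t : K) : Matrix.SpecialLinearGroup (Fin 2) K := ⟨!![1, t; 0, 1], by simp⟩
  let l (t : K) : Matrix.SpecialLinearGroup (Fin 2) K := ⟨!![1, 0; t, 1], by simp⟩
  have hu (t : K) : u t ∈ S := hU _ t rfl
  have hl (t : K) : l t ∈ S := hL _ t rfl
  have key (g : Matrix.SpecialLinearGroup (Fin 2) K) (hc : g.1 1 0 ≠ 0) : g ∈ S := by
    have hdet := g.2
    rw [Matrix.det_fin_two] at hdet
    have : g = u ((g.1 0 0 - 1) / g.1 1 0) * l (g.1 1 0) * u ((g.1 1 1 - 1) / g.1 1 0) := by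
      apply Subtype.ext
      change g.1 = !![1, _; 0, 1] * !![1, 0; _, 1] * !![1, _; 0, 1]
      rw [Matrix.eta_fin_two g.1]
      ext i j
      fin_cases i <;> fin_cases j <;> simp [Matrix.mul_apply, Fin.sum_univ_two] <;> field_simp
      · ring
      · linear_combination -hdet
      · ring
    rw [this]
    exact mul_mem (mul_mem (hu _) (hl _)) (hu _)
  rw [eq_top_iff]
  intro g _
  by_cases hc : g.1 1 0 = 0
  · have hdet := g.2
    rw [Matrix.det_fin_two, hc, mul_zero, sub_zero] at hdet
    have hg : g = l (-1) * (l 1 * g) := by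
      apply Subtype.ext
      change g.1 = !![1, 0; -1, 1] * (!![1, 0; 1, 1] * g.1)
      rw [← mul_assoc, Matrix.mul_fin_two]
      simp [← Matrix.one_fin_two]
    rw [hg]
    refine mul_mem (hl _) (key _ ?_)
    change (!![1, 0; 1, 1] * g.1 : Matrix (Fin 2) (Fin 2) K) 1 0 ≠ 0
    simpa [Matrix.mul_apply, Fin.sum_univ_two, hc] using left_ne_zero_of_mul_eq_one hdet
  · exact key g hc

theorem sl2TensorPowerAction_mul (m : ℕ) (g h : Matrix.SpecialLinearGroup (Fin 2) ℂ) :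
    sl2TensorPowerAction m (g * h) = sl2TensorPowerAction m g ∘ₗ sl2TensorPowerAction m h := by
  simp only [sl2TensorPowerAction, ← PiTensorProduct.map_comp, ← Matrix.mulVecLin_mul,
    Matrix.SpecialLinearGroup.coe_mul]

theorem sl2TensorPowerAction_one (m : ℕ) : sl2TensorPowerAction m 1 = LinearMap.id := by
  simp only [sl2TensorPowerAction, Matrix.SpecialLinearGroup.coe_one, Matrix.mulVecLin_one,
    PiTensorProduct.map_id]

/-- The submonoid of elements of `SL₂(ℂ)` fixing a tensor. -/
noncomputable def sl2Fixing (m : ℕ) (x : TensorPower ℂ m (Fin 2 → ℂ)) :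
    Submonoid (Matrix.SpecialLinearGroup (Fin 2) ℂ) where
  carrier := {g | sl2TensorPowerAction m g x = x}
  one_mem' := by simp [sl2TensorPowerAction_one]
  mul_mem' {g h} hg hh := by
    rw [Set.mem_ofPred_eq] at *
    rw [sl2TensorPowerAction_mul, LinearMap.comp_apply, hh, hg]

/-- The action on the `m`-th tensor power of `ℂ²` of a matrix in `𝔤𝔩₂(ℂ)`. -/
noncomputable def gl2TensorPowerLieAction (m : ℕ) (A : Matrix (Fin 2) (Fin 2) ℂ) :
    Module.End ℂ (TensorPower ℂ m (Fin 2 → ℂ)) :=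
  leibnizMap (Fin m) (Matrix.toLin' A)

theorem gl2TensorPowerLieAction_smul (m : ℕ) (t : ℂ) (A : Matrix (Fin 2) (Fin 2) ℂ) :
    gl2TensorPowerLieAction m (t • A) = t • gl2TensorPowerLieAction m A := by
  simp only [gl2TensorPowerLieAction, map_smul]

theorem gl2TensorPowerLieAction_lie (m : ℕ) (A B : Matrix (Fin 2) (Fin 2) ℂ) :
    ⁅gl2TensorPowerLieAction m A, gl2TensorPowerLieAction m B⁆ =
      gl2TensorPowerLieAction m ⁅A, B⁆ := by
  simp only [gl2TensorPowerLieAction]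
  rw [← leibnizMap_lie]
  congr 1
  simp only [Ring.lie_def, map_sub, Matrix.toLin'_mul, Module.End.mul_eq_comp]

theorem sl2TensorPowerAction_apply_eq_self_iff (m : ℕ) {g : Matrix.SpecialLinearGroup (Fin 2) ℂ}
    {A : Matrix (Fin 2) (Fin 2) ℂ} (hg : g.1 = 1 + A) (hA : A * A = 0)
    (x : TensorPower ℂ m (Fin 2 → ℂ)) :
    sl2TensorPowerAction m g x = x ↔ gl2TensorPowerLieAction m A x = 0 := by
  rw [gl2TensorPowerLieAction, ← map_one_add_apply_eq_self_iff
    (by rw [Module.End.mul_eq_comp, ← Matrix.toLin'_mul, hA, map_zero])]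
  simp only [sl2TensorPowerAction, hg, ← Matrix.toLin'_apply', map_add, Matrix.toLin'_one]
  rfl

theorem sl2Invariants_eq_ker_inf_ker (m : ℕ) :
    sl2Invariants m = LinearMap.ker (gl2TensorPowerLieAction m !![0, 1; 0, 0]) ⊓
      LinearMap.ker (gl2TensorPowerLieAction m !![0, 0; 1, 0]) := by
  ext x
  simp only [Submodule.mem_inf, LinearMap.mem_ker]
  constructor
  · intro hx
    exact ⟨(sl2TensorPowerAction_apply_eq_self_iff m (g := ⟨!![1, 1; 0, 1], by simp⟩)
        (by simp [Matrix.one_fin_two]) (by simp [← Matrix.ext_iff]) x).1 (hx _),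
      (sl2TensorPowerAction_apply_eq_self_iff m (g := ⟨!![1, 0; 1, 1], by simp⟩)
        (by simp [Matrix.one_fin_two]) (by simp [← Matrix.ext_iff]) x).1 (hx _)⟩
  · rintro ⟨he, hf⟩ g
    have htop : sl2Fixing m x = ⊤ := by
      refine Matrix.SpecialLinearGroup.submonoid_eq_top_of_transvection_mem
        (fun g t hg => ?_) fun g t hg => ?_
      · refine (sl2TensorPowerAction_apply_eq_self_iff m (A := t • !![0, 1; 0, 0])
          (by simp [Matrix.one_fin_two, hg]) (by simp [← Matrix.ext_iff]) x).2 ?_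
        rw [gl2TensorPowerLieAction_smul, LinearMap.smul_apply, he, smul_zero]
      · refine (sl2TensorPowerAction_apply_eq_self_iff m (A := t • !![0, 0; 1, 0])
          (by simp [Matrix.one_fin_two, hg]) (by simp [← Matrix.ext_iff]) x).2 ?_
        rw [gl2TensorPowerLieAction_smul, LinearMap.smul_apply, hf, smul_zero]
    exact (htop ▸ Submonoid.mem_top g : g ∈ sl2Fixing m x)

theorem card_filter_card_fiber_zero_eq {ι : Type*} [Fintype ι] [DecidableEq ι] (j : ℕ) :
    (Finset.univ.filter fun p : ι → Fin 2 => (Finset.univ.filter fun i => p i = 0).card = j).card =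
      (Fintype.card ι).choose j := by
  rw [← Finset.card_univ, ← Finset.card_powersetCard]
  refine Finset.card_nbij' (fun p => Finset.univ.filter fun i => p i = 0)
    (fun s i => if i ∈ s then 0 else 1) ?_ ?_ ?_ ?_
  · intro p hp
    simpa using hp
  · intro s hs
    simpa using hs
  · intro p _
    ext1 i
    by_cases h : p i = 0
    · simp [h]
    · simp [h]; omega
  · intro s _
    ext i
    simp

theorem sum_weights_eq {ι : Type*} [Fintype ι] (p : ι → Fin 2) :
    ∑ i, (![1, -1] : Fin 2 → ℂ) (p i) =
      ((2 * (Finset.univ.filter fun i => p i = 0).card - Fintype.card ι : ℤ) : ℂ) := by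
  have (k : Fin 2) : (![1, -1] : Fin 2 → ℂ) k = 2 * (if k = 0 then 1 else 0) - 1 := by
    fin_cases k <;> norm_num
  simp only [this, Finset.sum_sub_distrib, ← Finset.mul_sum, Finset.sum_boole]
  simp

theorem finrank_eigenspace_gl2TensorPowerLieAction (m : ℕ) (μ : ℤ) :
    Module.finrank ℂ ((gl2TensorPowerLieAction m !![1, 0; 0, -1]).eigenspace (μ : ℂ)) =
      (Finset.univ.filter fun p : Fin m → Fin 2 =>
        2 * ((Finset.univ.filter fun i => p i = 0).card : ℤ) - m = μ).card := by
  rw [gl2TensorPowerLieAction, Module.End.finrank_eigenspace_of_basis _ (leibnizMap_piTensorProduct_basis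
    (Pi.basisFun ℂ (Fin 2)) (c := ![1, -1]) fun k => ?_)]
  · simp only [sum_weights_eq, Int.cast_inj, Fintype.card_fin]
  · ext i
    fin_cases k <;> fin_cases i <;> simp [Matrix.mulVec, dotProduct]

theorem gl2TensorPowerLieAction_toMatrix_conjTranspose (m : ℕ) (A : Matrix (Fin 2) (Fin 2) ℂ) :
    (LinearMap.toMatrix (Basis.piTensorProduct fun _ : Fin m => Pi.basisFun ℂ (Fin 2))
      (Basis.piTensorProduct fun _ : Fin m => Pi.basisFun ℂ (Fin 2))
      (gl2TensorPowerLieAction m A)).conjTranspose =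
    LinearMap.toMatrix (Basis.piTensorProduct fun _ : Fin m => Pi.basisFun ℂ (Fin 2))
      (Basis.piTensorProduct fun _ : Fin m => Pi.basisFun ℂ (Fin 2))
      (gl2TensorPowerLieAction m A.conjTranspose) :=
  toMatrix_leibnizMap_conjTranspose _ (by
    simp only [LinearMap.toMatrix_eq_toMatrix', LinearMap.toMatrix'_toLin'])

theorem catalan_add_choose_succ (k : ℕ) :
    catalan k + (2 * k).choose (k + 1) = (2 * k).choose k := by
  have h1 := succ_mul_catalan_eq_centralBinom k
  have h2 := Nat.choose_succ_right_eq (2 * k) k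
  rw [Nat.centralBinom_eq_two_mul_choose] at h1
  rw [show 2 * k - k = k by omega] at h2
  refine Nat.eq_of_mul_eq_mul_left k.succ_pos ?_
  rw [Nat.succ_eq_add_one, mul_add, h1, mul_comm (k + 1) (Nat.choose _ (k + 1)), h2]
  ring

theorem sl2Invariants_eq_ker_inf_eigenspace (m : ℕ) :
    sl2Invariants m = LinearMap.ker (gl2TensorPowerLieAction m !![0, 1; 0, 0]) ⊓
      (gl2TensorPowerLieAction m !![1, 0; 0, -1]).eigenspace 0 := by
  rw [sl2Invariants_eq_ker_inf_ker]
  refine Module.End.ker_inf_ker_eq_of_lie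
    (b := Basis.piTensorProduct fun _ : Fin m => Pi.basisFun ℂ (Fin 2)) ?_ ?_
  · rw [gl2TensorPowerLieAction_toMatrix_conjTranspose]
    congr 2
    ext i j; fin_cases i <;> fin_cases j <;> simp
  · rw [gl2TensorPowerLieAction_lie]
    congr 1
    simp [Ring.lie_def]

theorem finrank_sl2Invariants_add (m : ℕ) :
    Module.finrank ℂ (sl2Invariants m) +
      Module.finrank ℂ ((gl2TensorPowerLieAction m !![1, 0; 0, -1]).eigenspace 2) =
      Module.finrank ℂ ((gl2TensorPowerLieAction m !![1, 0; 0, -1]).eigenspace 0) := by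
  rw [sl2Invariants_eq_ker_inf_eigenspace]
  refine Module.End.finrank_ker_inf_eigenspace_zero (F := gl2TensorPowerLieAction m !![0, 0; 1, 0])
    (b := Basis.piTensorProduct fun _ : Fin m => Pi.basisFun ℂ (Fin 2)) ?_ ?_ ?_ ?_
  · rw [gl2TensorPowerLieAction_toMatrix_conjTranspose]
    congr 2
    ext i j; fin_cases i <;> fin_cases j <;> simp
  · rw [gl2TensorPowerLieAction_lie]
    congr 1
    simp [Ring.lie_def]
  · rw [gl2TensorPowerLieAction_lie, ← gl2TensorPowerLieAction_smul]
    congr 1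
    ext i j; fin_cases i <;> fin_cases j <;> simp [Ring.lie_def]; norm_num
  · rw [gl2TensorPowerLieAction_lie, ← gl2TensorPowerLieAction_smul]
    congr 1
    ext i j; fin_cases i <;> fin_cases j <;> simp [Ring.lie_def]; norm_num

end Invariants

/-- **Almkvist–Dicks–Formanek.** For the natural action of `SL₂(ℂ)` on `V = ℂ²` extended
diagonally to tensor powers, the space of invariant tensors in `V^{⊗m}` is zero for odd `m`,
and for `m = 2k` it has dimension the `k`-th Catalan number `Cₖ = (2k choose k)/(k+1)`.
Equivalently, the Hilbert series of `ℂ⟨x₁,x₂⟩^{SL₂}` is `(1 − √(1−4t²))/(2t²)`. -/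
theorem almkvist_dicks_formanek_sl2_invariants :
    (∀ m : ℕ, Odd m → sl2Invariants m = ⊥) ∧
    (∀ k : ℕ, Module.finrank ℂ (sl2Invariants (2 * k)) = catalan k) := by
  constructor
  · intro m hm
    have h := finrank_eigenspace_gl2TensorPowerLieAction m 0
    rw [Finset.card_eq_zero.2 (Finset.filter_eq_empty_iff.2 fun p _ => by grind)] at h
    have h0 := finrank_sl2Invariants_add m
    rw [Int.cast_zero] at h
    have : FiniteDimensional ℂ (TensorPower ℂ m (Fin 2 → ℂ)) :=
      (Basis.piTensorProduct fun _ : Fin m => Pi.basisFun ℂ (Fin 2)).finiteDimensional_of_finite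
    exact Submodule.finrank_eq_zero.1 (by omega)
  · intro k
    have h := finrank_sl2Invariants_add (2 * k)
    have h0 := finrank_eigenspace_gl2TensorPowerLieAction (2 * k) 0
    have h2 := finrank_eigenspace_gl2TensorPowerLieAction (2 * k) 2
    rw [Int.cast_zero] at h0
    rw [Int.cast_ofNat] at h2
    have e0 (a : ℕ) : 2 * (a : ℤ) - (2 * k : ℕ) = 0 ↔ a = k := by omega
    have e2 (a : ℕ) : 2 * (a : ℤ) - (2 * k : ℕ) = 2 ↔ a = k + 1 := by omega
    simp only [e0, e2, card_filter_card_fiber_zero_eq, Fintype.card_fin] at h0 h2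
    have hc := catalan_add_choose_succ k
    omega
end
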